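/- arXiv:1810.04459 — 2 statements merged into one kernel-verified Lean document; each statement's English description precedes it below -/
import Mathlib

section
/- Let L, M and N be Lie superalgebras over a field F (char F ≠ 2,3) such that: (i) L and N act compatibly on one another and M and N act compatibly on one another; (ii) ˡ(ᵐn) = (−1)^{|l||m|} ᵐ(ˡn) for all homogeneous l ∈ L, m ∈ M, n ∈ N; (iii) the canonical homomorphisms [L,N]^N ⊗ M → N ⊗ M and [M,N]^N ⊗ L → N ⊗ L are trivial. Then the direct sum L ⊕ M acts on N by ⁽ˡ,ᵐ⁾n = ˡn + ᵐn, N acts on L ⊕ M by ⁿ(l,m) = (ⁿl, ⁿm), these are compatible Lie actions, and there is an isomorphism of Lie superalgebras (L ⊕ M) ⊗ N ≅ (L ⊗ N) ⊕ (M ⊗ N). -/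
/-!
Common definitions: Lie superalgebras over a field `F` (char ≠ 2,3 where needed),
graded ideals, centers, capability, epicenter, non-abelian tensor and exterior
products (characterized by generators-and-relations universal properties),
free Lie superalgebras, Schur multipliers, Heisenberg Lie superalgebras, etc.
-/

namespace SuperLie

open Submodule Function Module

universe u v w

/-- The sign `(-1)^{|a||b|}` attached to a pair of `ℤ₂`-degrees. -/
def sg (F : Type u) [Field F] (a b : ZMod 2) : F := (-1 : F) ^ (a.val * b.val)

/-- A Lie superalgebra over `F`: a `ℤ₂`-graded vector space `L = L₀ ⊕ L₁`
together with an even bilinear bracket satisfying graded skew-symmetry and the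
graded Jacobi identity (on homogeneous elements). -/
class LieSuper (F : Type u) [Field F] (L : Type v) [AddCommGroup L] [Module F L] where
  gr : ZMod 2 → Submodule F L
  isCompl_gr : IsCompl (gr 0) (gr 1)
  br : L → L → L
  br_add_left : ∀ x y z : L, br (x + y) z = br x z + br y z
  br_add_right : ∀ x y z : L, br x (y + z) = br x y + br x z
  br_smul_left : ∀ (c : F) (x y : L), br (c • x) y = c • br x y
  br_smul_right : ∀ (c : F) (x y : L), br x (c • y) = c • br x y
  br_gr : ∀ a b : ZMod 2, ∀ x ∈ gr a, ∀ y ∈ gr b, br x y ∈ gr (a + b)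
  br_skew : ∀ a b : ZMod 2, ∀ x ∈ gr a, ∀ y ∈ gr b, br x y = -(sg F a b) • br y x
  br_jacobi : ∀ a b c : ZMod 2, ∀ x ∈ gr a, ∀ y ∈ gr b, ∀ z ∈ gr c,
    sg F a c • br x (br y z) + sg F b a • br y (br z x) + sg F c b • br z (br x y) = 0

/-- The `a`-graded piece of a Lie superalgebra. -/
def grd (F : Type u) [Field F] (L : Type v) [AddCommGroup L] [Module F L] [LieSuper F L]
    (a : ZMod 2) : Submodule F L :=
  LieSuper.gr a

/-- The bracket of a Lie superalgebra. -/
def sbr (F : Type u) [Field F] {L : Type v} [AddCommGroup L] [Module F L] [LieSuper F L]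
    (x y : L) : L :=
  LieSuper.br (F := F) x y

/-- The center `Z(L) = {z ∈ L : [z,x] = 0 for all x ∈ L}`. -/
def centerS (F : Type u) [Field F] (L : Type v) [AddCommGroup L] [Module F L] [LieSuper F L] :
    Submodule F L where
  carrier := {z : L | ∀ x : L, sbr F z x = 0}
  add_mem' := by
    intro a b ha hb x
    simp only [Set.mem_setOf_eq, sbr] at ha hb ⊢
    rw [LieSuper.br_add_left, ha x, hb x, add_zero]
  zero_mem' := by
    intro x
    have h := LieSuper.br_smul_left (F := F) (0 : F) (0 : L) x
    simp only [Set.mem_setOf_eq, sbr, zero_smul] at h ⊢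
    simpa using h
  smul_mem' := by
    intro c a ha x
    simp only [Set.mem_setOf_eq, sbr] at ha ⊢
    rw [LieSuper.br_smul_left, ha x, smul_zero]

/-- Homomorphisms of Lie superalgebras: even (grading preserving) linear maps
which preserve the bracket. -/
def IsHom (F : Type u) [Field F] {L : Type v} {M : Type w}
    [AddCommGroup L] [Module F L] [LieSuper F L]
    [AddCommGroup M] [Module F M] [LieSuper F M] (f : L →ₗ[F] M) : Prop :=
  (∀ a : ZMod 2, ∀ x ∈ grd F L a, f x ∈ grd F M a) ∧
  (∀ x y : L, f (sbr F x y) = sbr F (f x) (f y))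

/-- A bundled Lie superalgebra over `F`. -/
structure LieSupAlg (F : Type u) [Field F] : Type (max u (v + 1)) where
  carrier : Type v
  [iag : AddCommGroup carrier]
  [imo : Module F carrier]
  [ils : LieSuper F carrier]

attribute [instance] LieSupAlg.iag LieSupAlg.imo LieSupAlg.ils

instance (F : Type u) [Field F] : CoeSort (LieSupAlg.{u, v} F) (Type v) :=
  ⟨LieSupAlg.carrier⟩

/-- A Lie superalgebra `L` is capable if `L ≅ H/Z(H)` for some Lie superalgebra `H`,
i.e. there is a surjective homomorphism onto `L` whose kernel is exactly the center. -/
def Capable (F : Type u) [Field F] (L : Type v) [AddCommGroup L] [Module F L]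
    [LieSuper F L] : Prop :=
  ∃ (H : LieSupAlg.{u, max u v} F) (φ : H.carrier →ₗ[F] L),
    IsHom F φ ∧ Surjective φ ∧ LinearMap.ker φ = centerS F H.carrier

/-- Graded ideals of a Lie superalgebra. -/
def IsGIdeal (F : Type u) [Field F] {L : Type v} [AddCommGroup L] [Module F L]
    [LieSuper F L] (I : Submodule F L) : Prop :=
  (∀ x ∈ I, ∀ y : L, sbr F x y ∈ I) ∧ (∀ y : L, ∀ x ∈ I, sbr F y x ∈ I) ∧
  (∀ x ∈ I, ∃ x0 ∈ I ⊓ grd F L 0, ∃ x1 ∈ I ⊓ grd F L 1, x = x0 + x1)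

/-- The graded ideal generated by a subset. -/
def idealClosure (F : Type u) [Field F] {L : Type v} [AddCommGroup L] [Module F L]
    [LieSuper F L] (S : Set L) : Submodule F L :=
  sInf {I : Submodule F L | IsGIdeal F I ∧ S ⊆ ↑I}

/-- `QuotCapable F L N` expresses that the quotient Lie superalgebra `L/N` is capable. -/
def QuotCapable (F : Type u) [Field F] (L : Type v) [AddCommGroup L] [Module F L]
    [LieSuper F L] (N : Submodule F L) : Prop :=
  ∃ (Q : LieSupAlg.{u, max u v} F) (π : L →ₗ[F] Q.carrier),
    IsHom F π ∧ Surjective π ∧ LinearMap.ker π = N ∧ Capable F Q.carrier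

/-- The epicenter `Z^*(L)`: the smallest graded ideal of `L` such that the
corresponding quotient is capable. -/
def IsEpicenter (F : Type u) [Field F] (L : Type v) [AddCommGroup L] [Module F L]
    [LieSuper F L] (Z : Submodule F L) : Prop :=
  IsGIdeal F Z ∧ QuotCapable F L Z ∧
  ∀ N : Submodule F L, IsGIdeal F N → QuotCapable F L N → Z ≤ N

/-- The submodule `[I,J]` spanned by brackets. -/
def bracketSpan (F : Type u) [Field F] {L : Type v} [AddCommGroup L] [Module F L]
    [LieSuper F L] (I J : Submodule F L) : Submodule F L :=
  Submodule.span F {z : L | ∃ x ∈ I, ∃ y ∈ J, z = sbr F x y}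

/-- The derived subalgebra `L' = [L,L]`. -/
def derived (F : Type u) [Field F] (L : Type v) [AddCommGroup L] [Module F L]
    [LieSuper F L] : Submodule F L :=
  bracketSpan F (⊤ : Submodule F L) ⊤

/-- The lower central series of a Lie superalgebra. -/
def lowerCentral (F : Type u) [Field F] (L : Type v) [AddCommGroup L] [Module F L]
    [LieSuper F L] : ℕ → Submodule F L
  | 0 => ⊤
  | n + 1 => bracketSpan F (lowerCentral F L n) ⊤

/-- A Lie superalgebra is nilpotent if its lower central series terminates at zero. -/
def IsNilp (F : Type u) [Field F] (L : Type v) [AddCommGroup L] [Module F L]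
    [LieSuper F L] : Prop :=
  ∃ n : ℕ, lowerCentral F L n = ⊥

/-- An action of a Lie superalgebra `P` on a Lie superalgebra `M`:
an even bilinear map satisfying the two action axioms. -/
structure IsAction (F : Type u) [Field F] {P : Type v} {M : Type v}
    [AddCommGroup P] [Module F P] [LieSuper F P]
    [AddCommGroup M] [Module F M] [LieSuper F M] (act : P → M → M) : Prop where
  add_left : ∀ (p q : P) (m : M), act (p + q) m = act p m + act q m
  add_right : ∀ (p : P) (m m' : M), act p (m + m') = act p m + act p m'
  smul_left : ∀ (c : F) (p : P) (m : M), act (c • p) m = c • act p m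
  smul_right : ∀ (c : F) (p : P) (m : M), act p (c • m) = c • act p m
  grade : ∀ a b : ZMod 2, ∀ p ∈ grd F P a, ∀ m ∈ grd F M b, act p m ∈ grd F M (a + b)
  br_act : ∀ a b : ZMod 2, ∀ p ∈ grd F P a, ∀ p' ∈ grd F P b, ∀ m : M,
    act (sbr F p p') m = act p (act p' m) - sg F a b • act p' (act p m)
  act_br : ∀ a b : ZMod 2, ∀ p ∈ grd F P a, ∀ m ∈ grd F M b, ∀ m' : M,
    act p (sbr F m m') = sbr F (act p m) m' + sg F a b • sbr F m (act p m')

/-- Compatibility of mutual actions of two Lie superalgebras on each other. -/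
def Compatible (F : Type u) [Field F] {M : Type v} {N : Type v}
    [AddCommGroup M] [Module F M] [LieSuper F M]
    [AddCommGroup N] [Module F N] [LieSuper F N]
    (actMN : M → N → N) (actNM : N → M → M) : Prop :=
  (∀ a b : ZMod 2, ∀ m ∈ grd F M a, ∀ n ∈ grd F N b, ∀ n' : N,
      actMN (actNM n m) n' = -(sg F a b) • sbr F (actMN m n) n') ∧
  (∀ a b : ZMod 2, ∀ m ∈ grd F M a, ∀ n ∈ grd F N b, ∀ m' : M,
      actNM (actMN m n) m' = -(sg F a b) • sbr F (actNM n m) m')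

/-- The defining relations of the non-abelian tensor product `M ⊗ N` of Lie
superalgebras (with given mutual actions), satisfied by a pairing `q` into `T`. -/
structure TensorRel (F : Type u) [Field F] {M : Type v} {N : Type v} {T : Type w}
    [AddCommGroup M] [Module F M] [LieSuper F M]
    [AddCommGroup N] [Module F N] [LieSuper F N]
    [AddCommGroup T] [Module F T] [LieSuper F T]
    (actMN : M → N → N) (actNM : N → M → M) (q : M → N → T) : Prop where
  add_left : ∀ (m m' : M) (n : N), q (m + m') n = q m n + q m' n
  add_right : ∀ (m : M) (n n' : N), q m (n + n') = q m n + q m n'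
  smul_left : ∀ (c : F) (m : M) (n : N), q (c • m) n = c • q m n
  smul_right : ∀ (c : F) (m : M) (n : N), q m (c • n) = c • q m n
  grade : ∀ a b : ZMod 2, ∀ m ∈ grd F M a, ∀ n ∈ grd F N b, q m n ∈ grd F T (a + b)
  brk_left : ∀ a b : ZMod 2, ∀ m ∈ grd F M a, ∀ m' ∈ grd F M b, ∀ n : N,
    q (sbr F m m') n = q m (actMN m' n) - sg F a b • q m' (actMN m n)
  brk_right : ∀ a b c : ZMod 2, ∀ m ∈ grd F M a, ∀ n ∈ grd F N b, ∀ n' ∈ grd F N c,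
    q m (sbr F n n') = sg F c (a + b) • q (actNM n' m) n - sg F a b • q (actNM n m) n'
  brk_brk : ∀ a b : ZMod 2, ∀ m ∈ grd F M a, ∀ n ∈ grd F N b, ∀ (m' : M) (n' : N),
    sbr F (q m n) (q m' n') = -(sg F a b) • q (actNM n m) (actMN m' n')

/-- `IsTensorObj F actMN actNM t` says that `(T, t)` is the non-abelian tensor
product `M ⊗ N`: the pairing `t` satisfies the defining relations and is
universal among all pairings satisfying them. -/
structure IsTensorObj (F : Type u) [Field F] {M : Type v} {N : Type v} {T : Type v}
    [AddCommGroup M] [Module F M] [LieSuper F M]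
    [AddCommGroup N] [Module F N] [LieSuper F N]
    [AddCommGroup T] [Module F T] [LieSuper F T]
    (actMN : M → N → N) (actNM : N → M → M) (t : M → N → T) : Prop where
  rel : TensorRel F actMN actNM t
  lift : ∀ (Q : LieSupAlg.{u, max u v} F) (q : M → N → Q.carrier),
    TensorRel F actMN actNM q →
    ∃! h : T →ₗ[F] Q.carrier, IsHom F h ∧ ∀ (m : M) (n : N), h (t m n) = q m n

/-- The defining relations of the non-abelian exterior square `L ∧ L` of a Lie
superalgebra (the tensor relations for the bracket actions, together with the
graded alternating relations coming from `L □ L`). -/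
structure ExtRel (F : Type u) [Field F] {L : Type v} {T : Type w}
    [AddCommGroup L] [Module F L] [LieSuper F L]
    [AddCommGroup T] [Module F T] [LieSuper F T] (q : L → L → T) : Prop where
  toTensor : TensorRel F (fun x y : L => sbr F x y) (fun x y : L => sbr F x y) q
  alt : ∀ a b : ZMod 2, ∀ x ∈ grd F L a, ∀ y ∈ grd F L b, q x y = -(sg F a b) • q y x
  alt_even : ∀ x ∈ grd F L 0, q x x = 0

/-- `IsExtObj F t` says that `(E, t)` is the non-abelian exterior square `L ∧ L`. -/
structure IsExtObj (F : Type u) [Field F] {L : Type v} {E : Type v}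
    [AddCommGroup L] [Module F L] [LieSuper F L]
    [AddCommGroup E] [Module F E] [LieSuper F E] (t : L → L → E) : Prop where
  rel : ExtRel F t
  lift : ∀ (Q : LieSupAlg.{u, max u v} F) (q : L → L → Q.carrier),
    ExtRel F q →
    ∃! h : E →ₗ[F] Q.carrier, IsHom F h ∧ ∀ x y : L, h (t x y) = q x y

/-- A free Lie superalgebra: free on some `ℤ₂`-graded subset `X`. -/
def IsFreeLieSuper (F : Type u) [Field F] (Fr : Type v) [AddCommGroup Fr] [Module F Fr]
    [LieSuper F Fr] : Prop :=
  ∃ X : ZMod 2 → Set Fr,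
    (∀ a : ZMod 2, X a ⊆ (grd F Fr a : Set Fr)) ∧
    ∀ (Q : LieSupAlg.{u, max u v} F) (f : ∀ a : ZMod 2, X a → Q.carrier),
      (∀ (a : ZMod 2) (x : X a), f a x ∈ grd F Q.carrier a) →
      ∃! h : Fr →ₗ[F] Q.carrier,
        IsHom F h ∧ ∀ (a : ZMod 2) (x : X a), h (x : Fr) = f a x

/-- `F' ∩ R`, for a free presentation with kernel `R`. -/
abbrev schurA (F : Type u) [Field F] (Fr : Type v) [AddCommGroup Fr] [Module F Fr]
    [LieSuper F Fr] (R : Submodule F Fr) : Submodule F Fr :=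
  derived F Fr ⊓ R

/-- The Schur multiplier `M(L) = (F' ∩ R)/[R,F]` attached to a free presentation
`0 → R → F → L → 0`. -/
abbrev SchurMul (F : Type u) [Field F] (Fr : Type v) [AddCommGroup Fr] [Module F Fr]
    [LieSuper F Fr] (R : Submodule F Fr) :=
  ↥(schurA F Fr R) ⧸ (Submodule.comap (schurA F Fr R).subtype (bracketSpan F R ⊤))

/-- `L` is (isomorphic to) the special Heisenberg Lie superalgebra `H(m,n)` with even
center: basis `x₁,…,x_{2m}, z` (even), `y₁,…,y_n` (odd), with `[xᵢ, x_{m+i}] = z`,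
`[y_j, y_j] = z` and `z` central. -/
def IsHeisE (F : Type u) [Field F] (m n : ℕ) (L : Type v) [AddCommGroup L] [Module F L]
    [LieSuper F L] : Prop :=
  ∃ (x : Fin (2 * m) → L) (y : Fin n → L) (z : L),
    (∀ i, x i ∈ grd F L 0) ∧ z ∈ grd F L 0 ∧ (∀ j, y j ∈ grd F L 1) ∧
    LinearIndependent F (Sum.elim x (Sum.elim y (fun _ : Unit => z))) ∧
    Submodule.span F (Set.range (Sum.elim x (Sum.elim y (fun _ : Unit => z)))) = ⊤ ∧
    (∀ i j : Fin (2 * m), sbr F (x i) (x j) =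
      if (j : ℕ) = (i : ℕ) + m then z else if (i : ℕ) = (j : ℕ) + m then -z else 0) ∧
    (∀ (i : Fin (2 * m)) (j : Fin n), sbr F (x i) (y j) = 0) ∧
    (∀ (i : Fin (2 * m)) (j : Fin n), sbr F (y j) (x i) = 0) ∧
    (∀ i j : Fin n, sbr F (y i) (y j) = if i = j then z else 0) ∧
    (∀ w : L, sbr F z w = 0) ∧ (∀ w : L, sbr F w z = 0)

/-- `L` is (isomorphic to) the Heisenberg Lie superalgebra `H_m` with odd center:
basis `x₁,…,x_m` (even), `y₁,…,y_m, z` (odd), with `[x_j, y_j] = z` and `z` central. -/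
def IsHeisO (F : Type u) [Field F] (m : ℕ) (L : Type v) [AddCommGroup L] [Module F L]
    [LieSuper F L] : Prop :=
  ∃ (x : Fin m → L) (y : Fin m → L) (z : L),
    (∀ i, x i ∈ grd F L 0) ∧ (∀ j, y j ∈ grd F L 1) ∧ z ∈ grd F L 1 ∧
    LinearIndependent F (Sum.elim x (Sum.elim y (fun _ : Unit => z))) ∧
    Submodule.span F (Set.range (Sum.elim x (Sum.elim y (fun _ : Unit => z)))) = ⊤ ∧
    (∀ i j : Fin m, sbr F (x i) (x j) = 0) ∧
    (∀ i j : Fin m, sbr F (x i) (y j) = if i = j then z else 0) ∧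
    (∀ i j : Fin m, sbr F (y j) (x i) = if i = j then -z else 0) ∧
    (∀ i j : Fin m, sbr F (y i) (y j) = 0) ∧
    (∀ w : L, sbr F z w = 0) ∧ (∀ w : L, sbr F w z = 0)

/-- `A` is (isomorphic to) the abelian Lie superalgebra `A(r | s)` of
superdimension `(r | s)`. -/
def IsAbelSuper (F : Type u) [Field F] (r s : ℕ) (A : Type v) [AddCommGroup A]
    [Module F A] [LieSuper F A] : Prop :=
  (∀ x y : A, sbr F x y = 0) ∧ Module.Finite F A ∧
  Module.finrank F ↥(grd F A 0) = r ∧ Module.finrank F ↥(grd F A 1) = s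

/-- The direct sum (product) of two Lie superalgebras. -/
instance prodLieSuper (F : Type u) [Field F] (A : Type v) (B : Type w)
    [AddCommGroup A] [Module F A] [LieSuper F A]
    [AddCommGroup B] [Module F B] [LieSuper F B] : LieSuper F (A × B) where
  gr a := (grd F A a).prod (grd F B a)
  isCompl_gr := by
    have hA : IsCompl (grd F A 0) (grd F A 1) := LieSuper.isCompl_gr
    have hB : IsCompl (grd F B 0) (grd F B 1) := LieSuper.isCompl_gr
    constructor
    · rw [disjoint_iff, eq_bot_iff]
      rintro ⟨a, b⟩ h
      rw [Submodule.mem_inf] at h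
      obtain ⟨h0, h1⟩ := h
      rw [Submodule.mem_prod] at h0 h1
      have ha : a = 0 := by
        have := hA.disjoint.le_bot (Submodule.mem_inf.mpr ⟨h0.1, h1.1⟩)
        simpa using this
      have hb : b = 0 := by
        have := hB.disjoint.le_bot (Submodule.mem_inf.mpr ⟨h0.2, h1.2⟩)
        simpa using this
      simp [ha, hb, Prod.ext_iff]
    · rw [codisjoint_iff, eq_top_iff]
      rintro ⟨a, b⟩ -
      have ha' : a ∈ grd F A 0 ⊔ grd F A 1 := by
        rw [hA.codisjoint.eq_top]; trivial
      have hb' : b ∈ grd F B 0 ⊔ grd F B 1 := by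
        rw [hB.codisjoint.eq_top]; trivial
      obtain ⟨a0, ha0, a1, ha1, rfl⟩ := Submodule.mem_sup.mp ha'
      obtain ⟨b0, hb0, b1, hb1, rfl⟩ := Submodule.mem_sup.mp hb'
      refine Submodule.mem_sup.mpr ⟨(a0, b0), ?_, (a1, b1), ?_, ?_⟩
      · exact Submodule.mem_prod.mpr ⟨ha0, hb0⟩
      · exact Submodule.mem_prod.mpr ⟨ha1, hb1⟩
      · rfl
  br x y := (sbr F x.1 y.1, sbr F x.2 y.2)
  br_add_left := by
    intro x y z
    simp only [Prod.fst_add, Prod.snd_add, sbr, LieSuper.br_add_left]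
    rfl
  br_add_right := by
    intro x y z
    simp only [Prod.fst_add, Prod.snd_add, sbr, LieSuper.br_add_right]
    rfl
  br_smul_left := by
    intro c x y
    simp only [Prod.smul_fst, Prod.smul_snd, sbr, LieSuper.br_smul_left]
    rfl
  br_smul_right := by
    intro c x y
    simp only [Prod.smul_fst, Prod.smul_snd, sbr, LieSuper.br_smul_right]
    rfl
  br_gr := by
    intro a b x hx y hy
    rw [Submodule.mem_prod] at hx hy ⊢
    exact ⟨LieSuper.br_gr a b x.1 hx.1 y.1 hy.1, LieSuper.br_gr a b x.2 hx.2 y.2 hy.2⟩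
  br_skew := by
    intro a b x hx y hy
    rw [Submodule.mem_prod] at hx hy
    have h1 := LieSuper.br_skew (F := F) a b x.1 hx.1 y.1 hy.1
    have h2 := LieSuper.br_skew (F := F) a b x.2 hx.2 y.2 hy.2
    simp only [sbr]
    rw [Prod.ext_iff]
    exact ⟨h1, h2⟩
  br_jacobi := by
    intro a b c x hx y hy z hz
    rw [Submodule.mem_prod] at hx hy hz
    have h1 := LieSuper.br_jacobi (F := F) a b c x.1 hx.1 y.1 hy.1 z.1 hz.1
    have h2 := LieSuper.br_jacobi (F := F) a b c x.2 hx.2 y.2 hy.2 z.2 hz.2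
    simp only [sbr]
    rw [Prod.ext_iff]
    exact ⟨h1, h2⟩

theorem sg_comm' (F : Type u) [Field F] (a b : ZMod 2) : sg F a b = sg F b a := by
  simp only [sg, Nat.mul_comm]

theorem sg_add_left' (F : Type u) [Field F] (a b c : ZMod 2) :
    sg F (a + b) c = sg F a c * sg F b c := by
  have h : ∀ a b c : ZMod 2,
      ((a + b).val * c.val) % 2 = (a.val * c.val + b.val * c.val) % 2 := by decide
  simp only [sg]
  rw [← pow_add, neg_one_pow_eq_pow_mod_two, h, ← neg_one_pow_eq_pow_mod_two]

theorem sg_add_right' (F : Type u) [Field F] (a b c : ZMod 2) :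
    sg F a (b + c) = sg F a b * sg F a c := by
  rw [sg_comm', sg_add_left', sg_comm' F b, sg_comm' F c]

theorem sg_cases (F : Type u) [Field F] (a b : ZMod 2) : sg F a b = 1 ∨ sg F a b = -1 :=
  neg_one_pow_eq_or F _

section basic

variable {F : Type u} [Field F] {L : Type v} [AddCommGroup L] [Module F L] [LieSuper F L]

theorem exists_homog (F : Type u) [Field F] {L : Type v} [AddCommGroup L] [Module F L]
    [LieSuper F L] (x : L) : ∃ x0 ∈ grd F L 0, ∃ x1 ∈ grd F L 1, x = x0 + x1 := by
  have hA : IsCompl (grd F L 0) (grd F L 1) := LieSuper.isCompl_gr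
  have hx : x ∈ grd F L 0 ⊔ grd F L 1 := by
    rw [hA.codisjoint.eq_top]; trivial
  obtain ⟨a0, h0, a1, h1, h⟩ := Submodule.mem_sup.mp hx
  exact ⟨a0, h0, a1, h1, h.symm⟩

@[elab_as_elim] theorem homog_ind (F : Type u) [Field F] {L : Type v} [AddCommGroup L] [Module F L]
    [LieSuper F L] {p : L → Prop} (h : ∀ a : ZMod 2, ∀ x ∈ grd F L a, p x)
    (hadd : ∀ x y, p x → p y → p (x + y)) (x : L) : p x := by
  obtain ⟨x0, h0, x1, h1, rfl⟩ := exists_homog F x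
  exact hadd _ _ (h _ _ h0) (h _ _ h1)

theorem sbr_add_left (x y z : L) : sbr F (x + y) z = sbr F x z + sbr F y z :=
  LieSuper.br_add_left x y z
theorem sbr_add_right (x y z : L) : sbr F x (y + z) = sbr F x y + sbr F x z :=
  LieSuper.br_add_right x y z
theorem sbr_smul_left (c : F) (x y : L) : sbr F (c • x) y = c • sbr F x y :=
  LieSuper.br_smul_left c x y
theorem sbr_smul_right (c : F) (x y : L) : sbr F x (c • y) = c • sbr F x y :=
  LieSuper.br_smul_right c x y
theorem sbr_zero_left (x : L) : sbr F 0 x = 0 := by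
  have := sbr_smul_left (0 : F) (0 : L) x
  simpa using this
theorem sbr_zero_right (x : L) : sbr F x 0 = 0 := by
  have := sbr_smul_right (0 : F) x (0 : L)
  simpa using this
theorem sbr_gr {a b : ZMod 2} {x y : L} (hx : x ∈ grd F L a) (hy : y ∈ grd F L b) :
    sbr F x y ∈ grd F L (a + b) := LieSuper.br_gr a b x hx y hy
theorem sbr_skew {a b : ZMod 2} {x y : L} (hx : x ∈ grd F L a) (hy : y ∈ grd F L b) :
    sbr F x y = -(sg F a b) • sbr F y x := LieSuper.br_skew a b x hx y hy

/-- Graded subalgebras. -/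
@[reducible] def subLieSuper (S : Submodule F L)
    (hbr : ∀ x ∈ S, ∀ y ∈ S, sbr F x y ∈ S)
    (hgr : ∀ x ∈ S, ∃ x0 ∈ S ⊓ grd F L 0, ∃ x1 ∈ S ⊓ grd F L 1, x = x0 + x1) :
    LieSuper F S where
  gr a := (grd F L a).comap S.subtype
  isCompl_gr := by
    have hA : IsCompl (grd F L 0) (grd F L 1) := LieSuper.isCompl_gr
    constructor
    · rw [disjoint_iff, eq_bot_iff]
      rintro ⟨a, ha⟩ h
      rw [Submodule.mem_inf] at h
      have := hA.disjoint.le_bot (Submodule.mem_inf.mpr ⟨h.1, h.2⟩)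
      simpa using this
    · rw [codisjoint_iff, eq_top_iff]
      rintro ⟨a, ha⟩ -
      obtain ⟨x0, h0, x1, h1, rfl⟩ := hgr a ha
      exact Submodule.mem_sup.mpr ⟨⟨x0, h0.1⟩, h0.2, ⟨x1, h1.1⟩, h1.2, rfl⟩
  br x y := ⟨sbr F x.1 y.1, hbr _ x.2 _ y.2⟩
  br_add_left x y z := Subtype.ext (sbr_add_left x.1 y.1 z.1)
  br_add_right x y z := Subtype.ext (sbr_add_right x.1 y.1 z.1)
  br_smul_left c x y := Subtype.ext (sbr_smul_left c x.1 y.1)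
  br_smul_right c x y := Subtype.ext (sbr_smul_right c x.1 y.1)
  br_gr a b x hx y hy := LieSuper.br_gr a b x.1 hx y.1 hy
  br_skew a b x hx y hy := Subtype.ext (LieSuper.br_skew a b x.1 hx y.1 hy)
  br_jacobi a b c x hx y hy z hz :=
    Subtype.ext (LieSuper.br_jacobi a b c x.1 hx y.1 hy z.1 hz)

/-- Universe lifting. -/
@[reducible] def uliftLieSuper (F : Type u) [Field F] (L : Type v) [AddCommGroup L] [Module F L]
    [LieSuper F L] : LieSuper F (ULift.{u} L) where
  gr a := (grd F L a).comap (ULift.moduleEquiv (R := F) (M := L)).toLinearMap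
  isCompl_gr := by
    have hA : IsCompl (grd F L 0) (grd F L 1) := LieSuper.isCompl_gr
    constructor
    · rw [disjoint_iff, eq_bot_iff]
      rintro ⟨a⟩ h
      rw [Submodule.mem_inf] at h
      have := hA.disjoint.le_bot (Submodule.mem_inf.mpr ⟨h.1, h.2⟩)
      exact ULift.ext _ _ (by simpa using this)
    · rw [codisjoint_iff, eq_top_iff]
      rintro ⟨a⟩ -
      obtain ⟨x0, h0, x1, h1, rfl⟩ := exists_homog F a
      exact Submodule.mem_sup.mpr ⟨⟨x0⟩, h0, ⟨x1⟩, h1, rfl⟩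
  br x y := ⟨sbr F x.1 y.1⟩
  br_add_left x y z := ULift.ext _ _ (sbr_add_left x.1 y.1 z.1)
  br_add_right x y z := ULift.ext _ _ (sbr_add_right x.1 y.1 z.1)
  br_smul_left c x y := ULift.ext _ _ (sbr_smul_left c x.1 y.1)
  br_smul_right c x y := ULift.ext _ _ (sbr_smul_right c x.1 y.1)
  br_gr a b x hx y hy := LieSuper.br_gr a b x.1 hx y.1 hy
  br_skew a b x hx y hy := ULift.ext _ _ (LieSuper.br_skew a b x.1 hx y.1 hy)
  br_jacobi a b c x hx y hy z hz :=
    ULift.ext _ _ (LieSuper.br_jacobi a b c x.1 hx y.1 hy z.1 hz)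

end basic

section tens

variable {F : Type u} [Field F] {M N T : Type v}
    [AddCommGroup M] [Module F M] [LieSuper F M]
    [AddCommGroup N] [Module F N] [LieSuper F N]
    [AddCommGroup T] [Module F T] [LieSuper F T]
    {actMN : M → N → N} {actNM : N → M → M} {t : M → N → T}

theorem TensorRel.zero_left {Q : Type w} [AddCommGroup Q] [Module F Q] [LieSuper F Q]
    {q : M → N → Q} (h : TensorRel F actMN actNM q) (n : N) : q 0 n = 0 := by
  simpa using h.smul_left 0 0 n

theorem TensorRel.zero_right {Q : Type w} [AddCommGroup Q] [Module F Q] [LieSuper F Q]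
    {q : M → N → Q} (h : TensorRel F actMN actNM q) (m : M) : q m 0 = 0 := by
  simpa using h.smul_right 0 m 0

theorem IsTensorObj.lift' (hT : IsTensorObj F actMN actNM t)
    (Q : Type v) [AddCommGroup Q] [Module F Q] [LieSuper F Q] (q : M → N → Q)
    (hq : TensorRel F actMN actNM q) :
    ∃! h : T →ₗ[F] Q, IsHom F h ∧ ∀ m n, h (t m n) = q m n := by
  letI := uliftLieSuper F Q
  let e : ULift.{u} Q ≃ₗ[F] Q := ULift.moduleEquiv
  obtain ⟨h, ⟨hh, hm⟩, hu⟩ := hT.lift ⟨ULift.{u} Q⟩ (fun m n => ⟨q m n⟩)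
    { add_left := fun m m' n => ULift.ext _ _ (hq.add_left m m' n)
      add_right := fun m m' n => ULift.ext _ _ (hq.add_right m m' n)
      smul_left := fun m m' n => ULift.ext _ _ (hq.smul_left m m' n)
      smul_right := fun m m' n => ULift.ext _ _ (hq.smul_right m m' n)
      grade := fun a b m hm n hn => hq.grade a b m hm n hn
      brk_left := fun a b m hm m' hm' n => ULift.ext _ _ (hq.brk_left a b m hm m' hm' n)
      brk_right := fun a b c m hm n hn n' hn' =>
        ULift.ext _ _ (hq.brk_right a b c m hm n hn n' hn')
      brk_brk := fun a b m hm n hn m' n' => ULift.ext _ _ (hq.brk_brk a b m hm n hn m' n') }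
  refine ⟨e.toLinearMap ∘ₗ h, ⟨⟨fun a x hx => hh.1 a x hx, fun x y => ?_⟩, fun m n => ?_⟩, ?_⟩
  · exact congrArg ULift.down (hh.2 x y)
  · exact congrArg ULift.down (hm m n)
  · rintro g ⟨hg, hgm⟩
    have := hu (e.symm.toLinearMap ∘ₗ g) ⟨⟨fun a x hx => hg.1 a x hx, fun x y =>
      ULift.ext _ _ (hg.2 x y)⟩, fun m n => ULift.ext _ _ (hgm m n)⟩
    rw [← this]
    ext x
    rfl

theorem IsTensorObj.hom_ext (hT : IsTensorObj F actMN actNM t)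
    {Q : Type v} [AddCommGroup Q] [Module F Q] [LieSuper F Q] {q : M → N → Q}
    (hq : TensorRel F actMN actNM q) {f g : T →ₗ[F] Q} (hf : IsHom F f) (hg : IsHom F g)
    (hfq : ∀ m n, f (t m n) = q m n) (hgq : ∀ m n, g (t m n) = q m n) : f = g :=
  (hT.lift' Q q hq).unique ⟨hf, hfq⟩ ⟨hg, hgq⟩

theorem IsHom.id' : IsHom F (LinearMap.id : T →ₗ[F] T) :=
  ⟨fun _ _ h => h, fun _ _ => rfl⟩

/-- The tensor product is linearly spanned by the generators. -/
theorem IsTensorObj.span_top (hT : IsTensorObj F actMN actNM t) :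
    Submodule.span F {z : T | ∃ m n, z = t m n} = ⊤ := by
  set S := Submodule.span F {z : T | ∃ m n, z = t m n} with hS
  have ht : ∀ m n, t m n ∈ S := fun m n => Submodule.subset_span ⟨m, n, rfl⟩
  have hbr0 : ∀ (m : M) (n : N) (m' : M) (n' : N), sbr F (t m n) (t m' n') ∈ S := by
    intro m n m' n'
    refine homog_ind F (fun a m hm => ?_) (fun x y hx hy => ?_) m
    · refine homog_ind F (fun b n hn => ?_) (fun x y hx hy => ?_) n
      · rw [hT.rel.brk_brk a b m hm n hn]
        exact S.smul_mem _ (ht _ _)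
      · rw [hT.rel.add_right, sbr_add_left]; exact S.add_mem hx hy
    · rw [hT.rel.add_left, sbr_add_left]; exact S.add_mem hx hy
  have hbr : ∀ x ∈ S, ∀ y ∈ S, sbr F x y ∈ S := by
    intro x hx y hy
    induction hx using Submodule.span_induction with
    | mem x h =>
      obtain ⟨m, n, rfl⟩ := h
      induction hy using Submodule.span_induction with
      | mem y h => obtain ⟨m', n', rfl⟩ := h; exact hbr0 _ _ _ _
      | zero => rw [sbr_zero_right]; exact S.zero_mem
      | add a b _ _ h1 h2 => rw [sbr_add_right]; exact S.add_mem h1 h2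
      | smul c a _ h => rw [sbr_smul_right]; exact S.smul_mem _ h
    | zero => rw [sbr_zero_left]; exact S.zero_mem
    | add a b _ _ h1 h2 => rw [sbr_add_left]; exact S.add_mem h1 h2
    | smul c a _ h => rw [sbr_smul_left]; exact S.smul_mem _ h
  have hsum : S ≤ (S ⊓ grd F T 0) ⊔ (S ⊓ grd F T 1) := by
    have hm : ∀ a : ZMod 2, ∀ z ∈ S, z ∈ grd F T a →
        z ∈ (S ⊓ grd F T 0) ⊔ (S ⊓ grd F T 1) := by
      intro a z hz hza
      have ha : a = 0 ∨ a = 1 := by clear hza; revert a; decide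
      rcases ha with rfl | rfl
      · exact Submodule.mem_sup_left ⟨hz, hza⟩
      · exact Submodule.mem_sup_right ⟨hz, hza⟩
    refine Submodule.span_le.mpr ?_
    rintro _ ⟨m, n, rfl⟩
    refine homog_ind F (p := fun m => t m n ∈ (S ⊓ grd F T 0) ⊔ (S ⊓ grd F T 1))
      (fun a m hm' => ?_) (fun x y hx hy => ?_) m
    · refine homog_ind F (p := fun n => t m n ∈ (S ⊓ grd F T 0) ⊔ (S ⊓ grd F T 1))
        (fun b n hn => ?_) (fun x y hx hy => ?_) n
      · exact hm (a + b) _ (ht _ _) (hT.rel.grade a b m hm' n hn)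
      · rw [hT.rel.add_right]; exact Submodule.add_mem _ hx hy
    · rw [hT.rel.add_left]; exact Submodule.add_mem _ hx hy
  have hgr : ∀ x ∈ S, ∃ x0 ∈ S ⊓ grd F T 0, ∃ x1 ∈ S ⊓ grd F T 1, x = x0 + x1 := by
    intro x hx
    obtain ⟨a0, h0, a1, h1, h⟩ := Submodule.mem_sup.mp (hsum hx)
    exact ⟨a0, h0, a1, h1, h.symm⟩
  letI := subLieSuper S hbr hgr
  have hq : TensorRel F actMN actNM (fun m n => (⟨t m n, ht m n⟩ : S)) :=
    { add_left := fun m m' n => Subtype.ext (hT.rel.add_left m m' n)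
      add_right := fun m m' n => Subtype.ext (hT.rel.add_right m m' n)
      smul_left := fun m m' n => Subtype.ext (hT.rel.smul_left m m' n)
      smul_right := fun m m' n => Subtype.ext (hT.rel.smul_right m m' n)
      grade := fun a b m hm n hn => hT.rel.grade a b m hm n hn
      brk_left := fun a b m hm m' hm' n => Subtype.ext (hT.rel.brk_left a b m hm m' hm' n)
      brk_right := fun a b c m hm n hn n' hn' =>
        Subtype.ext (hT.rel.brk_right a b c m hm n hn n' hn')
      brk_brk := fun a b m hm n hn m' n' => Subtype.ext (hT.rel.brk_brk a b m hm n hn m' n') }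
  obtain ⟨h, ⟨hh, hm⟩, -⟩ := hT.lift' S _ hq
  have key : S.subtype ∘ₗ h = LinearMap.id := by
    refine hT.hom_ext hT.rel ⟨fun a x hx => hh.1 a x hx, fun x y => ?_⟩ IsHom.id'
      (fun m n => ?_) (fun m n => rfl)
    · exact congrArg Subtype.val (hh.2 x y)
    · exact congrArg Subtype.val (hm m n)
  rw [eq_top_iff]
  intro x _
  have := LinearMap.congr_fun key x
  simp only [LinearMap.comp_apply, LinearMap.id_apply] at this
  rw [← this]
  exact (h x).2

/-- Existence of the twisted flip pairing. -/
theorem exists_flip (hN : IsAction F actNM) (hM : IsAction F actMN)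
    (ht : TensorRel F actMN actNM t) :
    ∃ q : N → M → T, TensorRel F actNM actMN q ∧
      ∀ a b : ZMod 2, ∀ n ∈ grd F N a, ∀ m ∈ grd F M b, q n m = -(sg F a b) • t m n := by
  have hcN : IsCompl (grd F N 1) (grd F N 0) :=
    IsCompl.symm (LieSuper.isCompl_gr (F := F) (L := N))
  have hcM : IsCompl (grd F M 1) (grd F M 0) :=
    IsCompl.symm (LieSuper.isCompl_gr (F := F) (L := M))
  obtain ⟨PN, hN0, hN1⟩ : ∃ P : N →ₗ[F] N, (∀ x ∈ grd F N 0, P x = 0) ∧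
      ∀ x ∈ grd F N 1, P x = x :=
    ⟨hcN.projection, fun x hx => (IsCompl.projection_apply_eq_zero_iff hcN).2 hx,
      fun x hx => hcN.projection_apply_left ⟨x, hx⟩⟩
  obtain ⟨PM, hM0, hM1⟩ : ∃ P : M →ₗ[F] M, (∀ x ∈ grd F M 0, P x = 0) ∧
      ∀ x ∈ grd F M 1, P x = x :=
    ⟨hcM.projection, fun x hx => (IsCompl.projection_apply_eq_zero_iff hcM).2 hx,
      fun x hx => hcM.projection_apply_left ⟨x, hx⟩⟩
  let q : N → M → T := fun n m => (2 : F) • t (PM m) (PN n) - t m n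
  have hqh : ∀ a b : ZMod 2, ∀ n ∈ grd F N a, ∀ m ∈ grd F M b,
      q n m = -(sg F a b) • t m n := by
    intro a b n hn m hm
    have ha : a = 0 ∨ a = 1 := by clear hn; revert a; decide
    have hb : b = 0 ∨ b = 1 := by clear hm; revert b; decide
    have e : (1 : ZMod 2).val = 1 := rfl
    rcases ha with rfl | rfl
    · simp [q, hN0 n hn, ht.zero_right, sg]
    · rcases hb with rfl | rfl
      · simp [q, hM0 m hm, ht.zero_left, sg]
      · simp only [q, hN1 n hn, hM1 m hm, sg, e]
        module
  have qal : ∀ x y m, q (x + y) m = q x m + q y m := by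
    intro x y m
    simp only [q, map_add, ht.add_right]; module
  have qar : ∀ x m m', q x (m + m') = q x m + q x m' := by
    intro x m m'
    simp only [q, map_add, ht.add_left]; module
  refine ⟨q, ⟨qal, qar, ?_, ?_, ?_, ?_, ?_, ?_⟩, hqh⟩
  · intro c x m
    simp only [q, map_smul, ht.smul_right]; module
  · intro c x m
    simp only [q, map_smul, ht.smul_left]; module
  · intro a b n hn m hm
    rw [hqh a b n hn m hm, add_comm]
    exact Submodule.smul_mem _ _ (ht.grade b a m hm n hn)
  · intro a b n hn n' hn' l
    refine homog_ind F (fun c l hl => ?_) (fun x y hx hy => ?_) l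
    · rw [hqh _ _ _ (sbr_gr hn hn') _ hl, ht.brk_right c a b l hl n hn n' hn',
        hqh _ _ _ hn _ (hN.grade _ _ _ hn' _ hl), hqh _ _ _ hn' _ (hN.grade _ _ _ hn _ hl)]
      simp only [sg_add_left', sg_add_right', sg_comm' F c, sg_comm' F b a]
      rcases sg_cases F a b with h1 | h1 <;> rcases sg_cases F a c with h2 | h2 <;>
        rcases sg_cases F b c with h3 | h3 <;> simp only [h1, h2, h3] <;> module
    · rw [qar, hN.add_right, hN.add_right, qar, qar, hx, hy]; module
  · intro a b c n hn m hm m' hm'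
    rw [hqh _ _ _ hn _ (sbr_gr hm hm'), ht.brk_left _ _ _ hm _ hm',
      hqh _ _ _ (hM.grade _ _ _ hm' _ hn) _ hm, hqh _ _ _ (hM.grade _ _ _ hm _ hn) _ hm']
    simp only [sg_add_left', sg_add_right', sg_comm' F c, sg_comm' F b a]
    rcases sg_cases F a b with h1 | h1 <;> rcases sg_cases F a c with h2 | h2 <;>
        rcases sg_cases F b c with h3 | h3 <;> simp only [h1, h2, h3] <;> module
  · intro a b n hn m hm n' m'
    refine homog_ind F (fun c n' hn' => ?_) (fun x y hx hy => ?_) n'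
    · refine homog_ind F (fun d m' hm' => ?_) (fun x y hx hy => ?_) m'
      · rw [hqh _ _ _ hn _ hm, hqh _ _ _ hn' _ hm',
          hqh _ _ _ (hM.grade _ _ _ hm _ hn) _ (hN.grade _ _ _ hn' _ hm'),
          sbr_smul_left, sbr_smul_right,
          sbr_skew (ht.grade _ _ _ hm _ hn) (ht.grade _ _ _ hm' _ hn'),
          ht.brk_brk _ _ _ hm' _ hn']
        simp only [sg_add_left', sg_add_right', sg_comm' F d c]
        rcases sg_cases F a b with h1 | h1 <;> rcases sg_cases F a c with h2 | h2 <;>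
          rcases sg_cases F b c with h3 | h3 <;> rcases sg_cases F a d with h4 | h4 <;>
          rcases sg_cases F b d with h5 | h5 <;> rcases sg_cases F c d with h6 | h6 <;>
          simp only [h1, h2, h3, h4, h5, h6] <;> module
      · rw [qar, sbr_add_right, hx, hy, hN.add_right, qar]; module
    · rw [qal, sbr_add_right, hx, hy, hN.add_left, qar]; module

end tens

/-- The key vanishing: `l ⊗ ᵐn = 0` in `L ⊗ N`. -/
theorem tens_vanish {F : Type u} [Field F] {L M N : Type v}
    [AddCommGroup L] [Module F L] [LieSuper F L]
    [AddCommGroup M] [Module F M] [LieSuper F M]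
    [AddCommGroup N] [Module F N] [LieSuper F N]
    {actLN : L → N → N} {actNL : N → L → L} {actMN : M → N → N}
    (hLN : IsAction F actLN) (hNL : IsAction F actNL) (hMN : IsAction F actMN)
    {TNL : Type v} [AddCommGroup TNL] [Module F TNL] [LieSuper F TNL]
    {tNL : N → L → TNL} (hTNL : IsTensorObj F actNL actLN tNL)
    (h3 : ∀ x ∈ idealClosure F {z : N | ∃ (m : M) (n : N), z = actMN m n},
      ∀ l : L, tNL x l = 0)
    {T : Type v} [AddCommGroup T] [Module F T] [LieSuper F T]
    {t : L → N → T} (ht : TensorRel F actLN actNL t) (l : L) (m : M) (n : N) :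
    t l (actMN m n) = 0 := by
  obtain ⟨q, hq, hqh⟩ := exists_flip hNL hLN ht
  obtain ⟨h, ⟨-, hh⟩, -⟩ := hTNL.lift' T q hq
  have hq0 : ∀ m n l, q (actMN m n) l = 0 := by
    intro m n l
    rw [← hh, h3 _ _ l, map_zero]
    refine Submodule.mem_sInf.2 fun I hI => hI.2 ⟨m, n, rfl⟩
  refine homog_ind F (fun a l hl => ?_) (fun x y hx hy => ?_) l
  · refine homog_ind F (fun b m hm => ?_) (fun x y hx hy => ?_) m
    · refine homog_ind F (fun c n hn => ?_) (fun x y hx hy => ?_) n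
      · have := hqh _ _ _ (hMN.grade _ _ _ hm _ hn) _ hl
        rw [hq0] at this
        rcases sg_cases F (b + c) a with h1 | h1 <;> rw [h1] at this <;> simpa using this.symm
      · rw [hMN.add_right, ht.add_right, hx, hy, add_zero]
    · rw [hMN.add_left, ht.add_right, hx, hy, add_zero]
  · rw [ht.add_left, hx, hy, add_zero]

theorem IsAction.zero_left {F : Type u} [Field F] {P M : Type v}
    [AddCommGroup P] [Module F P] [LieSuper F P]
    [AddCommGroup M] [Module F M] [LieSuper F M] {act : P → M → M} (h : IsAction F act)
    (m : M) : act 0 m = 0 := by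
  simpa using h.smul_left 0 0 m

theorem IsAction.zero_right {F : Type u} [Field F] {P M : Type v}
    [AddCommGroup P] [Module F P] [LieSuper F P]
    [AddCommGroup M] [Module F M] [LieSuper F M] {act : P → M → M} (h : IsAction F act)
    (p : P) : act p 0 = 0 := by
  simpa using h.smul_right 0 p 0

theorem mem_grd_prod {F : Type u} [Field F] {A : Type v} {B : Type w}
    [AddCommGroup A] [Module F A] [LieSuper F A]
    [AddCommGroup B] [Module F B] [LieSuper F B] {a : ZMod 2} {x : A × B} :
    x ∈ grd F (A × B) a ↔ x.1 ∈ grd F A a ∧ x.2 ∈ grd F B a := Iff.rfl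

theorem sbr_prod {F : Type u} [Field F] {A : Type v} {B : Type w}
    [AddCommGroup A] [Module F A] [LieSuper F A]
    [AddCommGroup B] [Module F B] [LieSuper F B] (x y : A × B) :
    sbr F x y = (sbr F x.1 y.1, sbr F x.2 y.2) := rfl

/-- distributivity of the non-abelian tensor product of Lie
superalgebras.  Under hypotheses (i)–(iii), the formulas
`⁽ˡ,ᵐ⁾n = ˡn + ᵐn` and `ⁿ(l,m) = (ⁿl, ⁿm)` define Lie actions of `L ⊕ M` on `N`
and of `N` on `L ⊕ M`, and with these actions
`(L ⊕ M) ⊗ N ≅ (L ⊗ N) ⊕ (M ⊗ N)`. -/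
theorem tensor_prod_distrib (F : Type u) [Field F]
    (hchar2 : (2 : F) ≠ 0) (hchar3 : (3 : F) ≠ 0)
    (L : Type v) [AddCommGroup L] [Module F L] [LieSuper F L]
    (M : Type v) [AddCommGroup M] [Module F M] [LieSuper F M]
    (N : Type v) [AddCommGroup N] [Module F N] [LieSuper F N]
    (actLN : L → N → N) (actNL : N → L → L)
    (actMN : M → N → N) (actNM : N → M → M)
    (hLN : IsAction F actLN) (hNL : IsAction F actNL)
    (hMN : IsAction F actMN) (hNM : IsAction F actNM)
    -- (i) the actions are compatible:
    (hcLN : Compatible F actLN actNL) (hcMN : Compatible F actMN actNM)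
    -- (ii) `ˡ(ᵐn) = (−1)^{|l||m|} ᵐ(ˡn)` for homogeneous `l, m`:
    (hii : ∀ a b : ZMod 2, ∀ l ∈ grd F L a, ∀ m ∈ grd F M b, ∀ n : N,
      actLN l (actMN m n) = sg F a b • actMN m (actLN l n))
    -- (iii) the canonical homomorphisms `[L,N]^N ⊗ M → N ⊗ M` and
    -- `[M,N]^N ⊗ L → N ⊗ L` are trivial:
    (TNM : Type v) [AddCommGroup TNM] [Module F TNM] [LieSuper F TNM]
    (tNM : N → M → TNM) (hTNM : IsTensorObj F actNM actMN tNM)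
    (TNL : Type v) [AddCommGroup TNL] [Module F TNL] [LieSuper F TNL]
    (tNL : N → L → TNL) (hTNL : IsTensorObj F actNL actLN tNL)
    (hiii₁ : ∀ x ∈ idealClosure F {z : N | ∃ (l : L) (n : N), z = actLN l n},
      ∀ m : M, tNM x m = 0)
    (hiii₂ : ∀ x ∈ idealClosure F {z : N | ∃ (m : M) (n : N), z = actMN m n},
      ∀ l : L, tNL x l = 0) :
    -- conclusion: the displayed formulas define Lie actions, and the tensor
    -- products decompose accordingly:
    IsAction F (fun (p : L × M) (n : N) => actLN p.1 n + actMN p.2 n) ∧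
    IsAction F (fun (n : N) (p : L × M) => (actNL n p.1, actNM n p.2)) ∧
    (∀ (T : Type v) [AddCommGroup T] [Module F T] [LieSuper F T]
       (TLN : Type v) [AddCommGroup TLN] [Module F TLN] [LieSuper F TLN]
       (TMN : Type v) [AddCommGroup TMN] [Module F TMN] [LieSuper F TMN]
       (t : L × M → N → T) (tLN : L → N → TLN) (tMN : M → N → TMN),
       IsTensorObj F (fun (p : L × M) (n : N) => actLN p.1 n + actMN p.2 n)
         (fun (n : N) (p : L × M) => (actNL n p.1, actNM n p.2)) t →
       IsTensorObj F actLN actNL tLN →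
       IsTensorObj F actMN actNM tMN →
       ∃ e : T ≃ₗ[F] TLN × TMN, IsHom F e.toLinearMap) := by
  refine ⟨?_, ?_, ?_⟩
  · refine ⟨?_, ?_, ?_, ?_, ?_, ?_, ?_⟩
    · intro p q m
      simp only [Prod.fst_add, Prod.snd_add, hLN.add_left, hMN.add_left]; abel
    · intro p m m'
      simp only [hLN.add_right, hMN.add_right]; abel
    · intro c p m
      simp only [Prod.smul_fst, Prod.smul_snd, hLN.smul_left, hMN.smul_left, smul_add]
    · intro c p m
      simp only [hLN.smul_right, hMN.smul_right, smul_add]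
    · intro a b p hp m hm
      exact Submodule.add_mem _ (hLN.grade a b _ hp.1 _ hm) (hMN.grade a b _ hp.2 _ hm)
    · intro a b p hp p' hp' n
      have e1 := hii a b _ hp.1 _ hp'.2 n
      have e2 := hii b a _ hp'.1 _ hp.2 n
      simp only [sbr_prod, hLN.br_act a b _ hp.1 _ hp'.1, hMN.br_act a b _ hp.2 _ hp'.2,
        hLN.add_right, hMN.add_right, e1, e2, sg_comm' F b a]
      rcases sg_cases F a b with h1 | h1 <;> simp only [h1] <;> module
    · intro a b p hp n hn n'
      simp only [hLN.act_br a b _ hp.1 _ hn, hMN.act_br a b _ hp.2 _ hn, sbr_add_left,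
        sbr_add_right]
      module
  · refine ⟨?_, ?_, ?_, ?_, ?_, ?_, ?_⟩
    · intro p q m
      simp only [hNL.add_left, hNM.add_left, Prod.mk_add_mk]
    · intro p m m'
      simp only [Prod.fst_add, Prod.snd_add, hNL.add_right, hNM.add_right, Prod.mk_add_mk]
    · intro c p m
      simp only [hNL.smul_left, hNM.smul_left, Prod.smul_mk]
    · intro c p m
      simp only [Prod.smul_fst, Prod.smul_snd, hNL.smul_right, hNM.smul_right, Prod.smul_mk]
    · intro a b p hp m hm
      exact ⟨hNL.grade a b _ hp _ hm.1, hNM.grade a b _ hp _ hm.2⟩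
    · intro a b p hp p' hp' n
      exact Prod.ext (hNL.br_act a b _ hp _ hp' _) (hNM.br_act a b _ hp _ hp' _)
    · intro a b p hp m hm m'
      exact Prod.ext (hNL.act_br a b _ hp _ hm.1 _) (hNM.act_br a b _ hp _ hm.2 _)
  · intro T _ _ _ TLN _ _ _ TMN _ _ _ t tLN tMN hT hTL hTM
    have vL : ∀ l m n, tLN l (actMN m n) = 0 := fun l m n =>
      tens_vanish hLN hNL hMN hTNL hiii₂ hTL.rel l m n
    have vM : ∀ m l n, tMN m (actLN l n) = 0 := fun m l n =>
      tens_vanish hMN hNM hLN hTNM hiii₁ hTM.rel m l n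
    have rL := hTL.rel
    have rM := hTM.rel
    have r := hT.rel
    have hq : TensorRel F (fun (p : L × M) (n : N) => actLN p.1 n + actMN p.2 n)
         (fun (n : N) (p : L × M) => (actNL n p.1, actNM n p.2))
         (fun p n => (tLN p.1 n, tMN p.2 n)) := by
      refine ⟨?_, ?_, ?_, ?_, ?_, ?_, ?_, ?_⟩
      · intro p q n
        exact Prod.ext (rL.add_left _ _ _) (rM.add_left _ _ _)
      · intro p n n'
        exact Prod.ext (rL.add_right _ _ _) (rM.add_right _ _ _)
      · intro c p n
        exact Prod.ext (rL.smul_left _ _ _) (rM.smul_left _ _ _)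
      · intro c p n
        exact Prod.ext (rL.smul_right _ _ _) (rM.smul_right _ _ _)
      · intro a b p hp n hn
        exact ⟨rL.grade a b _ hp.1 _ hn, rM.grade a b _ hp.2 _ hn⟩
      · intro a b p hp p' hp' n
        simp only [rL.add_right, rM.add_right, vL, vM, add_zero, zero_add]
        exact Prod.ext (rL.brk_left a b _ hp.1 _ hp'.1 _) (rM.brk_left a b _ hp.2 _ hp'.2 _)
      · intro a b c p hp n hn n' hn'
        exact Prod.ext (rL.brk_right a b c _ hp.1 _ hn _ hn')
          (rM.brk_right a b c _ hp.2 _ hn _ hn')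
      · intro a b p hp n hn p' n'
        simp only [rL.add_right, rM.add_right, vL, vM, add_zero, zero_add]
        exact Prod.ext (rL.brk_brk a b _ hp.1 _ hn _ _) (rM.brk_brk a b _ hp.2 _ hn _ _)
    obtain ⟨φ, ⟨hφ, hφt⟩, -⟩ := hT.lift' (TLN × TMN) _ hq
    have hf : TensorRel F actLN actNL (fun l n => t (l, 0) n) := by
      refine ⟨?_, ?_, ?_, ?_, ?_, ?_, ?_, ?_⟩
      · intro p q n
        rw [← r.add_left, Prod.mk_add_mk, add_zero]
      · intro p n n'
        exact r.add_right _ _ _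
      · intro c p n
        rw [← r.smul_left, Prod.smul_mk, smul_zero]
      · intro c p n
        exact r.smul_right _ _ _
      · intro a b p hp n hn
        exact r.grade a b _ ⟨hp, Submodule.zero_mem _⟩ _ hn
      · intro a b p hp p' hp' n
        have := r.brk_left a b (p, 0) ⟨hp, Submodule.zero_mem _⟩ (p', 0)
          ⟨hp', Submodule.zero_mem _⟩ n
        simpa only [sbr_prod, sbr_zero_left, hMN.zero_left, add_zero] using this
      · intro a b c p hp n hn n' hn'
        have := r.brk_right a b c (p, 0) ⟨hp, Submodule.zero_mem _⟩ n hn n' hn'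
        simpa only [hNM.zero_right] using this
      · intro a b p hp n hn p' n'
        have := r.brk_brk a b (p, 0) ⟨hp, Submodule.zero_mem _⟩ n hn (p', 0) n'
        simpa only [hNM.zero_right, hMN.zero_left, add_zero] using this
    have hg : TensorRel F actMN actNM (fun m n => t (0, m) n) := by
      refine ⟨?_, ?_, ?_, ?_, ?_, ?_, ?_, ?_⟩
      · intro p q n
        rw [← r.add_left, Prod.mk_add_mk, add_zero]
      · intro p n n'
        exact r.add_right _ _ _
      · intro c p n
        rw [← r.smul_left, Prod.smul_mk, smul_zero]
      · intro c p n
        exact r.smul_right _ _ _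
      · intro a b p hp n hn
        exact r.grade a b _ ⟨Submodule.zero_mem _, hp⟩ _ hn
      · intro a b p hp p' hp' n
        have := r.brk_left a b (0, p) ⟨Submodule.zero_mem _, hp⟩ (0, p')
          ⟨Submodule.zero_mem _, hp'⟩ n
        simpa only [sbr_prod, sbr_zero_left, hLN.zero_left, zero_add] using this
      · intro a b c p hp n hn n' hn'
        have := r.brk_right a b c (0, p) ⟨Submodule.zero_mem _, hp⟩ n hn n' hn'
        simpa only [hNL.zero_right] using this
      · intro a b p hp n hn p' n'
        have := r.brk_brk a b (0, p) ⟨Submodule.zero_mem _, hp⟩ n hn (0, p') n'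
        simpa only [hNL.zero_right, hLN.zero_left, zero_add] using this
    obtain ⟨f, ⟨-, hft⟩, -⟩ := hTL.lift' T _ hf
    obtain ⟨g, ⟨-, hgt⟩, -⟩ := hTM.lift' T _ hg
    have h1 : φ ∘ₗ (f.coprod g) = LinearMap.id := by
      apply LinearMap.prod_ext
      · refine LinearMap.ext_on hTL.span_top ?_
        rintro _ ⟨l, n, rfl⟩
        simp [hft, hφt, rM.zero_left]
      · refine LinearMap.ext_on hTM.span_top ?_
        rintro _ ⟨l, n, rfl⟩
        simp [hgt, hφt, rL.zero_left]
    have h2 : (f.coprod g) ∘ₗ φ = LinearMap.id := by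
      refine LinearMap.ext_on hT.span_top ?_
      rintro _ ⟨p, n, rfl⟩
      simp [hft, hgt, hφt, ← r.add_left]
    exact ⟨LinearEquiv.ofLinear φ (f.coprod g) h1 h2, hφ⟩

end SuperLie
end

section
/- For Lie superalgebras H and K over a field F (char F ≠ 2,3), the exterior center of the direct sum satisfies Z∧(H ⊕ K) ⊆ Z∧(H) ⊕ Z∧(K). -/
/-!
Common definitions: Lie superalgebras over a field `F` (char ≠ 2,3 where needed),
graded ideals, centers, capability, epicenter, non-abelian tensor and exterior
products (characterized by generators-and-relations universal properties),
free Lie superalgebras, Schur multipliers, Heisenberg Lie superalgebras, etc.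
-/

namespace SuperLie

open Submodule Function Module

universe u v w

/-- Universe lift of a Lie superalgebra. -/
instance uliftLieSuper_s3 (F : Type u) [Field F] (A : Type v)
    [AddCommGroup A] [Module F A] [LieSuper F A] : LieSuper F (ULift.{w} A) where
  gr a := (grd F A a).comap (ULift.moduleEquiv (R := F) (M := A)).toLinearMap
  isCompl_gr := by
    have hA : IsCompl (grd F A 0) (grd F A 1) := LieSuper.isCompl_gr
    constructor
    · rw [Submodule.disjoint_def]
      rintro ⟨a⟩ h0 h1
      have := Submodule.disjoint_def.mp hA.disjoint a h0 h1
      rw [this]; rfl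
    · rw [codisjoint_iff, eq_top_iff]
      rintro ⟨a⟩ -
      have ha' : a ∈ grd F A 0 ⊔ grd F A 1 := by
        rw [hA.codisjoint.eq_top]; trivial
      obtain ⟨a0, ha0, a1, ha1, rfl⟩ := Submodule.mem_sup.mp ha'
      exact Submodule.mem_sup.mpr ⟨⟨a0⟩, ha0, ⟨a1⟩, ha1, rfl⟩
  br x y := ⟨sbr F x.down y.down⟩
  br_add_left x y z := ULift.ext _ _ (LieSuper.br_add_left (F := F) x.down y.down z.down)
  br_add_right x y z := ULift.ext _ _ (LieSuper.br_add_right (F := F) x.down y.down z.down)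
  br_smul_left c x y := ULift.ext _ _ (LieSuper.br_smul_left (F := F) c x.down y.down)
  br_smul_right c x y := ULift.ext _ _ (LieSuper.br_smul_right (F := F) c x.down y.down)
  br_gr a b x hx y hy := LieSuper.br_gr (F := F) a b x.down hx y.down hy
  br_skew a b x hx y hy :=
    ULift.ext _ _ (LieSuper.br_skew (F := F) a b x.down hx y.down hy)
  br_jacobi a b c x hx y hy z hz :=
    ULift.ext _ _ (LieSuper.br_jacobi (F := F) a b c x.down hx y.down hy z.down hz)

theorem extRel_pull (F : Type u) [Field F] {L M T : Type v}
    [AddCommGroup L] [Module F L] [LieSuper F L]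
    [AddCommGroup M] [Module F M] [LieSuper F M]
    [AddCommGroup T] [Module F T] [LieSuper F T]
    (f : L →ₗ[F] M) (hf : IsHom F f) (t : M → M → T) (ht : ExtRel F t) :
    ExtRel F (fun x y : L => (ULift.up.{w} (t (f x) (f y)))) where
  toTensor :=
    { add_left := fun m m' n => ULift.ext _ _ (by
        simpa using ht.toTensor.add_left (f m) (f m') (f n))
      add_right := fun m n n' => ULift.ext _ _ (by
        simpa using ht.toTensor.add_right (f m) (f n) (f n'))
      smul_left := fun c m n => ULift.ext _ _ (by
        simpa using ht.toTensor.smul_left c (f m) (f n))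
      smul_right := fun c m n => ULift.ext _ _ (by
        simpa using ht.toTensor.smul_right c (f m) (f n))
      grade := fun a b m hm n hn =>
        ht.toTensor.grade a b (f m) (hf.1 a m hm) (f n) (hf.1 b n hn)
      brk_left := fun a b m hm m' hm' n => ULift.ext _ _ (by
        simpa [hf.2] using
          ht.toTensor.brk_left a b (f m) (hf.1 a m hm) (f m') (hf.1 b m' hm') (f n))
      brk_right := fun a b c m hm n hn n' hn' => ULift.ext _ _ (by
        simpa [hf.2] using
          ht.toTensor.brk_right a b c (f m) (hf.1 a m hm) (f n) (hf.1 b n hn)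
            (f n') (hf.1 c n' hn'))
      brk_brk := fun a b m hm n hn m' n' => ULift.ext _ _ (by
        have := ht.toTensor.brk_brk a b (f m) (hf.1 a m hm) (f n) (hf.1 b n hn) (f m') (f n')
        simp only [hf.2]
        exact this) }
  alt a b x hx y hy := ULift.ext _ _ (ht.alt a b (f x) (hf.1 a x hx) (f y) (hf.1 b y hy))
  alt_even x hx := ULift.ext _ _ (ht.alt_even (f x) (hf.1 0 x hx))

theorem ext_zero_of_hom (F : Type u) [Field F] {L M T E : Type v}
    [AddCommGroup L] [Module F L] [LieSuper F L]
    [AddCommGroup M] [Module F M] [LieSuper F M]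
    [AddCommGroup T] [Module F T] [LieSuper F T]
    [AddCommGroup E] [Module F E] [LieSuper F E]
    (f : L →ₗ[F] M) (hf : IsHom F f) (t : M → M → T) (ht : ExtRel F t)
    (s : L → L → E) (hs : IsExtObj F s) (x y : L) (h : s x y = 0) :
    t (f x) (f y) = 0 := by
  obtain ⟨g, ⟨-, hg⟩, -⟩ := hs.lift ⟨ULift.{u} T⟩ _ (extRel_pull.{u, v, u} F f hf t ht)
  have h1 := hg x y
  rw [h, map_zero] at h1
  exact (congrArg ULift.down h1).symm

/-- for Lie superalgebras `H` and `K`, the exterior center of the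
direct sum satisfies `Z∧(H ⊕ K) ⊆ Z∧(H) ⊕ Z∧(K)`. -/
theorem exterior_center_prod_le (F : Type u) [Field F]
    (hchar2 : (2 : F) ≠ 0) (hchar3 : (3 : F) ≠ 0)
    (H : Type v) [AddCommGroup H] [Module F H] [LieSuper F H]
    (K : Type v) [AddCommGroup K] [Module F K] [LieSuper F K]
    -- the exterior square of `H ⊕ K`:
    (E : Type v) [AddCommGroup E] [Module F E] [LieSuper F E]
    (t : H × K → H × K → E) (hE : IsExtObj F t)
    -- the exterior squares of `H` and `K`:
    (EH : Type v) [AddCommGroup EH] [Module F EH] [LieSuper F EH]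
    (tH : H → H → EH) (hEH : IsExtObj F tH)
    (EK : Type v) [AddCommGroup EK] [Module F EK] [LieSuper F EK]
    (tK : K → K → EK) (hEK : IsExtObj F tK) :
    ∀ p : H × K, (∀ q : H × K, t p q = 0) →
      (∀ y : H, tH p.1 y = 0) ∧ (∀ y : K, tK p.2 y = 0) := by
  intro p hp
  refine ⟨fun y => ?_, fun y => ?_⟩
  · exact ext_zero_of_hom F (LinearMap.fst F H K)
      ⟨fun a x hx => (Submodule.mem_prod.mp hx).1, fun x y => rfl⟩ tH hEH.rel t hE p (y, 0) (hp _)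
  · exact ext_zero_of_hom F (LinearMap.snd F H K)
      ⟨fun a x hx => (Submodule.mem_prod.mp hx).2, fun x y => rfl⟩ tK hEK.rel t hE p (0, y) (hp _)

end SuperLie
end
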